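/- Define L₁, L₂ : ℝ → ℂ by L₁(θ) = (π/2)(1+i)(e^{iθ/2} + i·e^{−iθ/2}) + iπ and L₂(θ) = (π/2)(1−i)(e^{iθ/2} − i·e^{−iθ/2}) − iπ, and set u(θ) = e^{iθ/2} + i·e^{−iθ/2}. Then for every θ ∈ ℝ: L₁(θ)·L₂′(θ) = (iπ²/4)·u(θ)² − (π²/4)(1−i)·u(θ). -/

import Mathlib

open Real

/-- With `L₁, L₂` the Clifford torus logarithms and
`u(θ) = e^{iθ/2} + i e^{−iθ/2}`, one has the pointwise identity
`L₁(θ)·L₂′(θ) = (iπ²/4)·u(θ)² − (π²/4)(1−i)·u(θ)`. -/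
theorem cliffordTorus_integrand_decomposition
    (L₁ L₂ u : ℝ → ℂ)
    (hL₁ : ∀ θ : ℝ, L₁ θ = ((π : ℂ) / 2) * (1 + Complex.I) *
      (Complex.exp (Complex.I * θ / 2) + Complex.I * Complex.exp (-(Complex.I * θ / 2)))
      + Complex.I * (π : ℂ))
    (hL₂ : ∀ θ : ℝ, L₂ θ = ((π : ℂ) / 2) * (1 - Complex.I) *
      (Complex.exp (Complex.I * θ / 2) - Complex.I * Complex.exp (-(Complex.I * θ / 2)))
      - Complex.I * (π : ℂ))
    (hu : ∀ θ : ℝ, u θ =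
      Complex.exp (Complex.I * θ / 2) + Complex.I * Complex.exp (-(Complex.I * θ / 2))) :
    ∀ θ : ℝ, L₁ θ * deriv L₂ θ
      = (Complex.I * (π : ℂ) ^ 2 / 4) * (u θ) ^ 2
        - ((π : ℂ) ^ 2 / 4) * (1 - Complex.I) * (u θ) := by
  intro θ
  have h0 : HasDerivAt (fun t : ℝ => Complex.I * (t : ℂ) / 2) (Complex.I / 2) θ := by
    have h := ((Complex.ofRealCLM.hasDerivAt (x := θ)).const_mul Complex.I).div_const 2
    simpa using h
  have h1 := h0.cexp
  have h2 := h0.neg.cexp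
  have h3 := ((h1.sub (h2.const_mul Complex.I)).const_mul
    (((π : ℂ) / 2) * (1 - Complex.I))).sub_const (Complex.I * (π : ℂ))
  have h4 : HasDerivAt L₂ (((π : ℂ) / 2) * (1 - Complex.I) * (Complex.I / 2) * u θ) θ := by
    rw [funext hL₂, hu]
    refine h3.congr_deriv ?_
    simp only [Pi.neg_apply]
    ring
  rw [h4.deriv, hL₁, ← hu]
  linear_combination (-(Complex.I * (π : ℂ) ^ 2 / 8) * u θ ^ 2
    + ((π : ℂ) ^ 2 / 4) * (1 - Complex.I) * u θ) * Complex.I_sq
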